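/- Let (V, R, α ↦ α∨) be a reduced crystallographic root system whose roots span V*, with Weyl group W. Fix a base Δ ⊆ R (a set of simple roots), with corresponding positive roots R₊ and negative roots R₋ = −R₊. Let S ⊆ Δ, let W_H ≤ W be the subgroup generated by { s_α : α ∈ S }, let R_H := R ∩ (ℤ-span of S), and let N := R₋ \ R_H. Let Sym(V*) be the symmetric algebra of V* over ℝ (the ring of polynomial functions on V), with W acting by ring automorphisms extending its action on V*, and let Q be its fraction field. Set π := ∏_{α ∈ N} α ∈ Sym(V*), a non-zero element. Then: (i) u(π) = π for every u ∈ W_H; (ii) for every f ∈ Sym(V*) fixed by all elements of W_H, the element w(f·π⁻¹) ∈ Q depends only on the left coset wW_H, and the finite sum Σ_{[w] ∈ W/W_H} w(f·π⁻¹) lies in Sym(V*) ⊆ Q and is fixed by every element of W. -/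

import Mathlib

open Module

/-- A reduced crystallographic root system on a real vector space `V`:
the roots are a finite set of non-zero linear functionals on `V`, each root `α`
has a coroot `α∨ ∈ V` with `α(α∨) = 2`, pairings of roots with coroots are
integers, the reflections `s_α : x ↦ x - α(x)·α∨` (resp. their dual actions
`λ ↦ λ - λ(α∨)·α`) permute the coroots (resp. the roots), and the only roots
proportional to a root `α` are `±α`. -/
structure RedCrystRootSystem (V : Type*) [AddCommGroup V] [Module ℝ V] where
  R : Finset (Module.Dual ℝ V)
  coroot : Module.Dual ℝ V → V
  ne_zero : ∀ α ∈ R, α ≠ 0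
  root_coroot_two : ∀ α ∈ R, α (coroot α) = 2
  crystallographic : ∀ α ∈ R, ∀ β ∈ R, ∃ n : ℤ, β (coroot α) = (n : ℝ)
  refl_root_mem : ∀ α ∈ R, ∀ β ∈ R, β - β (coroot α) • α ∈ R
  refl_coroot_mem : ∀ α ∈ R, ∀ β ∈ R,
    ∃ γ ∈ R, coroot β - α (coroot β) • coroot α = coroot γ
  reduced : ∀ α ∈ R, ∀ β ∈ R, ∀ c : ℝ, β = c • α → β = α ∨ β = -α

namespace RedCrystRootSystem

variable {V : Type*} [AddCommGroup V] [Module ℝ V] (S : RedCrystRootSystem V)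

/-- The reflection `s_α : x ↦ x - α(x)·α∨` associated to a root `α`, as a linear map. -/
def reflMap (α : Module.Dual ℝ V) : V →ₗ[ℝ] V :=
  LinearMap.id - α.smulRight (S.coroot α)

@[simp] lemma reflMap_apply (α : Module.Dual ℝ V) (x : V) :
    S.reflMap α x = x - α x • S.coroot α := rfl

/-- A linear automorphism of `V` is a reflection of the root system if it is
given by `x ↦ x - α(x)·α∨` for some root `α`. -/
def IsReflection (e : V ≃ₗ[ℝ] V) : Prop :=
  ∃ α ∈ S.R, ∀ x : V, e x = x - α x • S.coroot α

/-- The Weyl group: the subgroup of linear automorphisms of `V` generated by the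
reflections `s_α`, `α ∈ R`. -/
def weylGroup : Subgroup (V ≃ₗ[ℝ] V) :=
  Subgroup.closure {e : V ≃ₗ[ℝ] V | S.IsReflection e}

/-- The coroot lattice `Q∨`: the additive subgroup of `V` generated by the coroots. -/
def corootLattice : AddSubgroup V :=
  AddSubgroup.closure (S.coroot '' ↑S.R)

end RedCrystRootSystem

/-- `e` fixes the point `t` of the torus `V ⧸ Λ`. This is expressed by asking for an
additive endomorphism of `V ⧸ Λ` covering `e` (which exists iff `e` preserves `Λ`,
and is then unique) fixing `t`. -/
def FixesInTorus {V : Type*} [AddCommGroup V] [Module ℝ V]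
    (Λ : AddSubgroup V) (e : V ≃ₗ[ℝ] V) (t : V ⧸ Λ) : Prop :=
  ∃ f : (V ⧸ Λ) →+ (V ⧸ Λ),
    (∀ x : V, f (QuotientAddGroup.mk x) = QuotientAddGroup.mk (e x)) ∧ f t = t

namespace RedCrystRootSystem

variable {V : Type*} [AddCommGroup V] [Module ℝ V] (S : RedCrystRootSystem V)

/-- `Δ` is a base (a set of simple roots) of the root system: a linearly independent
set of roots such that every root is a ℤ-linear combination of elements of `Δ` with
either all coefficients nonnegative or all coefficients nonpositive. -/
def IsBase (Δ : Finset (Module.Dual ℝ V)) : Prop :=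
  (↑Δ : Set (Module.Dual ℝ V)) ⊆ ↑S.R ∧
  LinearIndependent ℝ (fun a : (Δ : Set (Module.Dual ℝ V)) => (a : Module.Dual ℝ V)) ∧
  ∀ β ∈ S.R,
    (∃ c : Module.Dual ℝ V → ℤ, β = ∑ α ∈ Δ, (c α : ℝ) • α ∧ ∀ α ∈ Δ, 0 ≤ c α) ∨
    (∃ c : Module.Dual ℝ V → ℤ, β = ∑ α ∈ Δ, (c α : ℝ) • α ∧ ∀ α ∈ Δ, c α ≤ 0)

/-- The positive roots relative to a base `Δ`. -/
def posRoots (Δ : Finset (Module.Dual ℝ V)) : Set (Module.Dual ℝ V) :=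
  {β | β ∈ S.R ∧
    ∃ c : Module.Dual ℝ V → ℤ, β = ∑ α ∈ Δ, (c α : ℝ) • α ∧ ∀ α ∈ Δ, 0 ≤ c α}

/-- The negative roots relative to a base `Δ`. -/
def negRoots (Δ : Finset (Module.Dual ℝ V)) : Set (Module.Dual ℝ V) :=
  {β | β ∈ S.R ∧ -β ∈ S.posRoots Δ}

/-- The subgroup `W_H` of the Weyl group generated by the reflections `s_α`, `α ∈ S₀`,
associated to a subset `S₀` of the simple roots. -/
def parabolic (S₀ : Finset (Module.Dual ℝ V)) : Subgroup (V ≃ₗ[ℝ] V) :=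
  Subgroup.closure {e : V ≃ₗ[ℝ] V | ∃ α ∈ S₀, ∀ x : V, e x = x - α x • S.coroot α}

end RedCrystRootSystem

open scoped Classical in
/-- The symmetric algebra `Sym(V*)` of the dual of `V`, realised faithfully (as `ℝ` is
infinite) as the subalgebra of the ring of functions `V → ℝ` generated by the linear
functionals on `V`. -/
def polyAlg (V : Type*) [AddCommGroup V] [Module ℝ V] : Subalgebra ℝ (V → ℝ) :=
  Algebra.adjoin ℝ (Set.range fun l : Module.Dual ℝ V => ⇑l)

section PolyAlg

variable {V : Type*} [AddCommGroup V] [Module ℝ V]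

/-- A linear functional, as an element of `polyAlg V`. -/
def polyLin (l : Module.Dual ℝ V) : polyAlg V :=
  ⟨l, Algebra.subset_adjoin ⟨l, rfl⟩⟩

@[simp] lemma coe_polyLin (l : Module.Dual ℝ V) : (polyLin l : V → ℝ) = l := rfl

lemma polyLin_neg (l : Module.Dual ℝ V) : polyLin (-l) = -polyLin l := rfl

/-! `rw` and `simp` do not identify the negation of a subalgebra with that of its ring structure,
nor the `ℝ`-module structures on `Module.Dual ℝ V`, so a few general facts are restated. -/

lemma polyAlg_neg_mul (p q : polyAlg V) : -p * q = -(p * q) := neg_mul p q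

lemma polyAlg_mul_neg (p q : polyAlg V) : p * -q = -(p * q) := mul_neg p q

lemma polyAlg_neg_dvd (p q : polyAlg V) : -p ∣ q ↔ p ∣ q :=
  ⟨fun ⟨r, h⟩ => ⟨-r, by rw [h, polyAlg_neg_mul, polyAlg_mul_neg]⟩,
    fun ⟨r, h⟩ => ⟨-r, by rw [h, polyAlg_neg_mul, polyAlg_mul_neg, neg_neg]⟩⟩

lemma polyLin_eq_zero {l : Module.Dual ℝ V} : polyLin l = 0 ↔ l = 0 := by
  constructor
  · intro h
    ext x
    exact congrFun (congrArg Subtype.val h) x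
  · rintro rfl
    rfl

lemma comp_mem_polyAlg (L : V →ₗ[ℝ] V) {p : V → ℝ} (hp : p ∈ polyAlg V) :
    p ∘ L ∈ polyAlg V := by
  induction hp using Algebra.adjoin_induction with
  | mem p hp =>
    obtain ⟨l, rfl⟩ := hp
    exact (polyLin (l ∘ₗ L)).2
  | algebraMap r => exact (polyAlg V).algebraMap_mem r
  | add p q _ _ hp hq => exact (polyAlg V).add_mem hp hq
  | mul p q _ _ hp hq => exact (polyAlg V).mul_mem hp hq

/-- Precomposition of polynomial functions with a linear endomorphism. -/
def polyComp (L : V →ₗ[ℝ] V) : polyAlg V →ₐ[ℝ] polyAlg V where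
  toFun p := ⟨(p : V → ℝ) ∘ L, comp_mem_polyAlg L p.2⟩
  map_one' := rfl
  map_mul' _ _ := rfl
  map_zero' := rfl
  map_add' _ _ := rfl
  commutes' _ := rfl

lemma polyComp_polyLin (L : V →ₗ[ℝ] V) (l : Module.Dual ℝ V) :
    polyComp L (polyLin l) = polyLin (l ∘ₗ L) := rfl

lemma exists_polynomial_eval_line {p : V → ℝ} (hp : p ∈ polyAlg V) (x v : V) :
    ∃ P : Polynomial ℝ, ∀ t : ℝ, p (x + t • v) = P.eval t := by
  induction hp using Algebra.adjoin_induction with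
  | mem p hp =>
    obtain ⟨l, rfl⟩ := hp
    exact ⟨.C (l x) + .C (l v) * .X, fun t => by simpa using mul_comm _ _⟩
  | algebraMap r => exact ⟨.C r, fun t => by simp⟩
  | add p q _ _ hp hq =>
    obtain ⟨P, hP⟩ := hp
    obtain ⟨P', hP'⟩ := hq
    exact ⟨P + P', fun t => by simp [hP, hP']⟩
  | mul p q _ _ hp hq =>
    obtain ⟨P, hP⟩ := hp
    obtain ⟨P', hP'⟩ := hq
    exact ⟨P * P', fun t => by simp [hP, hP']⟩

instance : IsDomain (polyAlg V) := by
  have : NoZeroDivisors (polyAlg V) := by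
    refine ⟨fun {p q} h => ?_⟩
    by_contra! hpq
    obtain ⟨⟨x, hx⟩, ⟨y, hy⟩⟩ : (∃ x, (p : V → ℝ) x ≠ 0) ∧ ∃ y, (q : V → ℝ) y ≠ 0 := by
      refine ⟨?_, ?_⟩ <;> by_contra! h0
      · exact hpq.1 (Subtype.ext (funext h0))
      · exact hpq.2 (Subtype.ext (funext h0))
    obtain ⟨P, hP⟩ := exists_polynomial_eval_line p.2 x (y - x)
    obtain ⟨P', hP'⟩ := exists_polynomial_eval_line q.2 x (y - x)
    have hmul : P * P' = 0 := Polynomial.funext fun t => by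
      have := congrFun (congrArg Subtype.val h) (x + t • (y - x))
      simpa [hP, hP'] using this
    rcases mul_eq_zero.1 hmul with h0 | h0
    · apply hx
      simpa [h0] using hP 0
    · apply hy
      simpa [h0] using hP' 1
  exact NoZeroDivisors.to_isDomain _

lemma intCast_smul_dual (n : ℤ) (l : Module.Dual ℝ V) : (n : ℝ) • l = n • l :=
  Int.cast_smul_eq_zsmul ℝ n l

lemma sub_smul_dual (a b : ℝ) (l : Module.Dual ℝ V) : (a - b) • l = a • l - b • l :=
  sub_smul a b l

/-- The projection of `V` onto `ker β` along `v`, when `β v = 2`. -/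
noncomputable def kerProj (β : Module.Dual ℝ V) (v : V) : V →ₗ[ℝ] V :=
  LinearMap.id - β.smulRight ((2⁻¹ : ℝ) • v)

lemma kerProj_apply (β : Module.Dual ℝ V) (v x : V) :
    kerProj β v x = x - β x • (2⁻¹ : ℝ) • v := rfl

lemma apply_kerProj {β : Module.Dual ℝ V} {v : V} (h : β v = 2) (x : V) :
    β (kerProj β v x) = 0 := by
  simp [kerProj_apply, h]

lemma polyLin_dvd_sub_polyComp_kerProj (β : Module.Dual ℝ V) (v : V) (p : polyAlg V) :
    polyLin β ∣ p - polyComp (kerProj β v) p := by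
  obtain ⟨p, hp⟩ := p
  induction hp using Algebra.adjoin_induction with
  | mem p hp =>
    obtain ⟨l, rfl⟩ := hp
    refine ⟨algebraMap ℝ _ (2⁻¹ * l v), Subtype.ext (funext fun x => ?_)⟩
    change l x - l (kerProj β v x) = β x * (2⁻¹ * l v)
    simp [kerProj_apply]
  | algebraMap r =>
    refine ⟨0, Subtype.ext (funext fun x => ?_)⟩
    change r - r = β x * 0
    simp
  | add p q hp hq ihp ihq =>
    convert dvd_add ihp ihq using 1
    refine Subtype.ext (funext fun x => ?_)
    change p x + q x - (p _ + q _) = p x - p _ + (q x - q _)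
    ring
  | mul p q hp hq ihp ihq =>
    convert dvd_add (ihp.mul_right ⟨q, hq⟩)
      (ihq.mul_left (polyComp (kerProj β v) ⟨p, hp⟩)) using 1
    refine Subtype.ext (funext fun x => ?_)
    change p x * q x - (p _ * q _) = (p x - p _) * q x + p _ * (q x - q _)
    ring

lemma polyLin_dvd_of_polyComp_kerProj_eq_zero {β : Module.Dual ℝ V} {v : V} {p : polyAlg V}
    (h : polyComp (kerProj β v) p = 0) : polyLin β ∣ p := by
  simpa [h] using polyLin_dvd_sub_polyComp_kerProj β v p

lemma polyComp_kerProj_polyLin_ne_zero {β γ : Module.Dual ℝ V} {v : V}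
    (h : ∀ c : ℝ, γ ≠ c • β) : polyComp (kerProj β v) (polyLin γ) ≠ 0 := by
  rw [polyComp_polyLin, Ne, polyLin_eq_zero]
  intro h0
  refine h (2⁻¹ * γ v) (LinearMap.ext fun x => ?_)
  have := LinearMap.congr_fun h0 x
  simp only [LinearMap.comp_apply, kerProj_apply, map_sub, map_smul, smul_eq_mul,
    LinearMap.zero_apply] at this
  simp only [LinearMap.smul_apply, smul_eq_mul]
  linarith

/-- A polynomial function vanishing on the kernels of pairwise non-proportional functionals is
divisible by their product. -/
lemma prod_polyLin_dvd (c : Module.Dual ℝ V → V) (A : Finset (Module.Dual ℝ V))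
    (hc : ∀ β ∈ A, β (c β) = 2)
    (hA : ∀ β ∈ A, ∀ γ ∈ A, γ ≠ β → ∀ r : ℝ, γ ≠ r • β) (p : polyAlg V)
    (hp : ∀ β ∈ A, polyComp (kerProj β (c β)) p = 0) : ∏ β ∈ A, polyLin β ∣ p := by
  classical
  induction A using Finset.induction_on with
  | empty => simp
  | insert β A hβ ih =>
    obtain ⟨q, rfl⟩ := ih (fun γ hγ => hc γ (by simp [hγ]))
      (fun γ hγ δ hδ => hA γ (by simp [hγ]) δ (by simp [hδ]))
      (fun γ hγ => hp γ (by simp [hγ]))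
    rw [Finset.prod_insert hβ, mul_comm (polyLin β)]
    refine mul_dvd_mul_left _ (polyLin_dvd_of_polyComp_kerProj_eq_zero (v := c β) ?_)
    have h := hp β (by simp)
    rw [map_mul, map_prod] at h
    refine (mul_eq_zero.1 h).resolve_left (Finset.prod_ne_zero_iff.2 fun γ hγ => ?_)
    exact polyComp_kerProj_polyLin_ne_zero
      (hA β (by simp) γ (by simp [hγ]) (by rintro rfl; exact hβ hγ))

end PolyAlg

namespace RedCrystRootSystem

variable {V : Type*} [AddCommGroup V] [Module ℝ V] (S : RedCrystRootSystem V)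

variable {S} in
lemma neg_mem {α : Module.Dual ℝ V} (h : α ∈ S.R) : -α ∈ S.R := by
  have := S.refl_root_mem α h α h
  rw [S.root_coroot_two α h] at this
  convert this using 1
  module

lemma inv_eq_of_reflection {α : Module.Dual ℝ V} (hα : α ∈ S.R) {e : V ≃ₗ[ℝ] V}
    (he : ∀ x, e x = x - α x • S.coroot α) : e⁻¹ = e := by
  rw [inv_eq_iff_mul_eq_one]
  ext x
  simp only [LinearEquiv.mul_apply, LinearEquiv.coe_one, id_eq, he, map_sub, map_smul,
    S.root_coroot_two α hα, smul_eq_mul]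
  module

lemma comp_mem_and_comp_inv_mem {w : V ≃ₗ[ℝ] V} (hw : w ∈ S.weylGroup) :
    ∀ α ∈ S.R, α ∘ₗ (w : V →ₗ[ℝ] V) ∈ S.R ∧ α ∘ₗ ((w⁻¹ : V ≃ₗ[ℝ] V) : V →ₗ[ℝ] V) ∈ S.R := by
  induction hw using Subgroup.closure_induction with
  | mem e he =>
    obtain ⟨β, hβ, he⟩ := he
    intro α hα
    rw [S.inv_eq_of_reflection hβ he, and_self]
    convert S.refl_root_mem β hβ α hα using 1
    ext x
    simp [he, mul_comm]
  | one => exact fun α hα => ⟨hα, hα⟩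
  | mul w w' _ _ ih ih' =>
    intro α hα
    refine ⟨(ih' _ (ih α hα).1).1, ?_⟩
    rw [mul_inv_rev]
    exact (ih _ (ih' α hα).2).2
  | inv w _ ih =>
    intro α hα
    rw [inv_inv]
    exact (ih α hα).symm

variable {S}

lemma comp_mem {w : V ≃ₗ[ℝ] V} (hw : w ∈ S.weylGroup) {α : Module.Dual ℝ V} (hα : α ∈ S.R) :
    α ∘ₗ (w : V →ₗ[ℝ] V) ∈ S.R := (S.comp_mem_and_comp_inv_mem hw α hα).1

section Half

/-- A set of roots containing exactly one element of each pair `{α, -α}`. -/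
structure IsHalf (S : RedCrystRootSystem V) (T : Finset (Module.Dual ℝ V)) : Prop where
  subset : T ⊆ S.R
  mem_or_neg_mem : ∀ α ∈ S.R, α ∈ T ∨ -α ∈ T
  neg_notMem : ∀ α ∈ T, -α ∉ T

variable {T : Finset (Module.Dual ℝ V)}

lemma IsHalf.ne_smul (hT : S.IsHalf T) {β γ : Module.Dual ℝ V} (hβ : β ∈ T) (hγ : γ ∈ T)
    (hne : γ ≠ β) (r : ℝ) : γ ≠ r • β := by
  intro h
  rcases S.reduced β (hT.subset hβ) γ (hT.subset hγ) r h with rfl | rfl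
  · exact hne rfl
  · exact hT.neg_notMem _ hβ hγ

/-- The Weyl group maps a product of roots from a half system to another such product,
up to sign. -/
lemma IsHalf.exists_polyComp_prod (hT : S.IsHalf T) {w : V ≃ₗ[ℝ] V} (hw : w ∈ S.weylGroup)
    {A : Finset (Module.Dual ℝ V)} (hA : A ⊆ T) :
    ∃ B ⊆ T, B.card = A.card ∧
      (polyComp (w : V →ₗ[ℝ] V) (∏ α ∈ A, polyLin α) = ∏ α ∈ B, polyLin α ∨
        polyComp (w : V →ₗ[ℝ] V) (∏ α ∈ A, polyLin α) = -∏ α ∈ B, polyLin α) := by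
  classical
  let τ : Module.Dual ℝ V → Module.Dual ℝ V := fun α =>
    if α ∘ₗ (w : V →ₗ[ℝ] V) ∈ T then α ∘ₗ (w : V →ₗ[ℝ] V) else -(α ∘ₗ (w : V →ₗ[ℝ] V))
  have hτ : ∀ α, τ α = α ∘ₗ (w : V →ₗ[ℝ] V) ∨ τ α = -(α ∘ₗ (w : V →ₗ[ℝ] V)) := by
    intro α
    simp only [τ]
    split_ifs <;> simp
  have hcancel : ∀ α β : Module.Dual ℝ V,
      α ∘ₗ (w : V →ₗ[ℝ] V) = β ∘ₗ (w : V →ₗ[ℝ] V) → α = β := by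
    intro α β h
    ext x
    simpa using LinearMap.congr_fun h (w.symm x)
  have hinj : Set.InjOn τ A := by
    intro α hα β hβ h
    have key : α = β ∨ α = -β := by
      rcases hτ α with h1 | h1 <;> rcases hτ β with h2 | h2 <;> rw [h1, h2] at h
      · exact .inl (hcancel _ _ h)
      · exact .inr (hcancel _ _ h)
      · exact .inr (hcancel _ _ (by rw [LinearMap.neg_comp, ← h, neg_neg]))
      · exact .inl (hcancel _ _ (neg_inj.1 h))
    refine key.resolve_right ?_
    rintro rfl
    exact hT.neg_notMem β (hA hβ) (hA hα)
  refine ⟨A.image τ, ?_, Finset.card_image_of_injOn hinj, ?_⟩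
  · intro γ hγ
    obtain ⟨α, hα, rfl⟩ := Finset.mem_image.1 hγ
    simp only [τ]
    split_ifs with h
    · exact h
    · exact (hT.mem_or_neg_mem _ (comp_mem hw (hT.subset (hA hα)))).resolve_left h
  · rw [Finset.prod_image hinj, map_prod]
    clear hinj hA
    induction A using Finset.induction_on with
    | empty => simp
    | insert β A hβ ih =>
      rw [Finset.prod_insert hβ, Finset.prod_insert hβ, polyComp_polyLin]
      rcases ih with h | h <;> rcases hτ β with h2 | h2 <;> rw [h, h2] <;>
        simp [polyLin_neg, polyAlg_neg_mul, polyAlg_mul_neg]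

lemma IsHalf.polyComp_prod_dvd (hT : S.IsHalf T) {w : V ≃ₗ[ℝ] V} (hw : w ∈ S.weylGroup)
    {A : Finset (Module.Dual ℝ V)} (hA : A ⊆ T) :
    polyComp (w : V →ₗ[ℝ] V) (∏ α ∈ A, polyLin α) ∣ ∏ α ∈ T, polyLin α := by
  obtain ⟨B, hB, -, h | h⟩ := hT.exists_polyComp_prod hw hA <;> rw [h]
  · exact Finset.prod_dvd_prod_of_subset _ _ _ hB
  · exact (polyAlg_neg_dvd _ _).2 (Finset.prod_dvd_prod_of_subset _ _ _ hB)

lemma IsHalf.prod_ne_zero (hT : S.IsHalf T) {A : Finset (Module.Dual ℝ V)} (hA : A ⊆ T) :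
    ∏ α ∈ A, polyLin α ≠ 0 :=
  Finset.prod_ne_zero_iff.2 fun α hα h =>
    S.ne_zero α (hT.subset (hA hα)) (polyLin_eq_zero.1 h)

lemma polyComp_comp (L L' : V →ₗ[ℝ] V) (p : polyAlg V) :
    polyComp L' (polyComp L p) = polyComp (L ∘ₗ L') p := rfl

lemma reflection_comp_kerProj {β : Module.Dual ℝ V} (hβ : β ∈ S.R) {e : V ≃ₗ[ℝ] V}
    (he : ∀ x, e x = x - β x • S.coroot β) :
    (e : V →ₗ[ℝ] V) ∘ₗ kerProj β (S.coroot β) = kerProj β (S.coroot β) := by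
  ext x
  simp [he, apply_kerProj (S.root_coroot_two β hβ)]

/-- A reflection changes the sign of the product of the roots in a half system. -/
lemma IsHalf.polyComp_reflection_prod (hT : S.IsHalf T) {β : Module.Dual ℝ V} (hβ : β ∈ T)
    {e : V ≃ₗ[ℝ] V} (he : ∀ x, e x = x - β x • S.coroot β) :
    polyComp (e : V →ₗ[ℝ] V) (∏ α ∈ T, polyLin α) = -∏ α ∈ T, polyLin α := by
  classical
  have hβR := hT.subset hβ
  have hew : e ∈ S.weylGroup := Subgroup.subset_closure ⟨β, hβR, he⟩
  obtain ⟨B, hB, hcard, h | h⟩ := hT.exists_polyComp_prod hew (Finset.Subset.refl T) <;>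
    obtain rfl := Finset.eq_of_subset_of_card_le hB hcard.ge
  swap
  · exact h
  exfalso
  have hβe : β ∘ₗ (e : V →ₗ[ℝ] V) = -β := by
    ext x
    simp only [LinearMap.comp_apply, LinearEquiv.coe_coe, he, map_sub, map_smul,
      S.root_coroot_two β hβR, smul_eq_mul, LinearMap.neg_apply]
    ring
  rw [← Finset.mul_prod_erase _ _ hβ, map_mul, polyComp_polyLin, hβe, polyLin_neg,
    polyAlg_neg_mul, ← polyAlg_mul_neg] at h
  have h' := mul_left_cancel₀ (mt polyLin_eq_zero.1 (S.ne_zero β hβR)) h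
  have h'' := congrArg (polyComp (kerProj β (S.coroot β))) h'
  rw [map_neg, polyComp_comp, reflection_comp_kerProj hβR he, neg_eq_self, map_prod] at h''
  refine Finset.prod_ne_zero_iff.2 (fun γ hγ => ?_) h''
  exact polyComp_kerProj_polyLin_ne_zero
    (hT.ne_smul hβ (Finset.mem_of_mem_erase hγ) (Finset.ne_of_mem_erase hγ))

/-- A polynomial function changing sign under the reflections in a half system is divisible by
the product of its roots. -/
lemma IsHalf.prod_dvd_of_polyComp_eq_neg (hT : S.IsHalf T) {p : polyAlg V}
    (hp : ∀ β ∈ T, ∀ e : V ≃ₗ[ℝ] V, (∀ x, e x = x - β x • S.coroot β) →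
      polyComp (e : V →ₗ[ℝ] V) p = -p) :
    ∏ α ∈ T, polyLin α ∣ p := by
  refine prod_polyLin_dvd S.coroot T (fun β hβ => S.root_coroot_two β (hT.subset hβ))
    (fun β hβ γ hγ h => hT.ne_smul hβ hγ h) p fun β hβ => ?_
  have h2 := S.root_coroot_two β (hT.subset hβ)
  have he : ∀ x, Module.reflection h2 x = x - β x • S.coroot β := fun x => Module.reflection_apply x h2
  have h := congrArg (polyComp (kerProj β (S.coroot β))) (hp β hβ _ he)
  rw [map_neg, polyComp_comp, reflection_comp_kerProj (hT.subset hβ) he] at h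
  exact self_eq_neg.1 h

end Half

section Base

variable {Δ S₀ : Finset (Module.Dual ℝ V)}

lemma IsBase.coeff_unique (hΔ : S.IsBase Δ) {c d : Module.Dual ℝ V → ℤ}
    (h : ∑ α ∈ Δ, (c α : ℝ) • α = ∑ α ∈ Δ, (d α : ℝ) • α) : ∀ α ∈ Δ, c α = d α := by
  have hli : LinearIndepOn ℝ id (Δ : Set (Module.Dual ℝ V)) := hΔ.2.1
  intro α hα
  have := linearIndepOn_finset_iff.1 hli (fun α => (c α : ℝ) - d α)
    (by simp [sub_smul, Finset.sum_sub_distrib, h]) α hα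
  exact_mod_cast sub_eq_zero.1 this

lemma mem_negRoots_iff {β : Module.Dual ℝ V} :
    β ∈ S.negRoots Δ ↔ β ∈ S.R ∧ ∃ c : Module.Dual ℝ V → ℤ,
      β = ∑ α ∈ Δ, (c α : ℝ) • α ∧ ∀ α ∈ Δ, c α ≤ 0 := by
  constructor
  · rintro ⟨hβ, -, c, hc, h0⟩
    refine ⟨hβ, -c, ?_, by simpa using h0⟩
    rw [← neg_neg β, hc, ← Finset.sum_neg_distrib]
    exact Finset.sum_congr rfl fun α _ => by
      rw [Pi.neg_apply, Int.cast_neg]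
      exact (neg_smul (c α : ℝ) α).symm
  · rintro ⟨hβ, c, hc, h0⟩
    refine ⟨hβ, neg_mem hβ, -c, ?_, by simpa using h0⟩
    rw [hc, ← Finset.sum_neg_distrib]
    exact Finset.sum_congr rfl fun α _ => by
      rw [Pi.neg_apply, Int.cast_neg]
      exact (neg_smul (c α : ℝ) α).symm

open scoped Classical in
lemma IsBase.isHalf (hΔ : S.IsBase Δ) : S.IsHalf {β ∈ S.R | β ∈ S.negRoots Δ} where
  subset := Finset.filter_subset _ _
  mem_or_neg_mem α hα := by
    simp only [Finset.mem_filter]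
    rcases hΔ.2.2 α hα with h | h
    · exact .inr ⟨neg_mem hα, neg_mem hα, by simpa using ⟨hα, h⟩⟩
    · exact .inl ⟨hα, mem_negRoots_iff.2 ⟨hα, h⟩⟩
  neg_notMem α hα h' := by
    obtain ⟨-, c, hc, hc0⟩ := mem_negRoots_iff.1 (Finset.mem_filter.1 hα).2
    obtain ⟨hR, -, d, hd, hd0⟩ := (Finset.mem_filter.1 h').2
    rw [neg_neg] at hd
    have h := hΔ.coeff_unique (hc.symm.trans hd)
    refine S.ne_zero α (Finset.mem_filter.1 hα).1 ?_
    rw [hc]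
    refine Finset.sum_eq_zero fun γ hγ => ?_
    have : c γ = 0 := le_antisymm (hc0 γ hγ) (h γ hγ ▸ hd0 γ hγ)
    simp [this]

lemma IsBase.refl_mem_negRoots (hΔ : S.IsBase Δ) (hS₀ : S₀ ⊆ Δ) {α β : Module.Dual ℝ V}
    (hα : α ∈ S₀) (hβ : β ∈ S.negRoots Δ)
    (hβ₀ : β ∉ AddSubgroup.closure (S₀ : Set (Module.Dual ℝ V))) :
    β - β (S.coroot α) • α ∈ S.negRoots Δ ∧
      β - β (S.coroot α) • α ∉ AddSubgroup.closure (S₀ : Set (Module.Dual ℝ V)) := by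
  classical
  have hαR : α ∈ S.R := hΔ.1 (hS₀ hα)
  obtain ⟨hβR, c, hc, hc0⟩ := mem_negRoots_iff.1 hβ
  obtain ⟨n, hn⟩ := S.crystallographic α hαR β hβR
  have hs := S.refl_root_mem α hαR β hβR
  rw [hn, intCast_smul_dual] at hs ⊢
  have hα₀ : n • α ∈ AddSubgroup.closure (S₀ : Set (Module.Dual ℝ V)) :=
    zsmul_mem (AddSubgroup.subset_closure hα) n
  refine ⟨mem_negRoots_iff.2 ⟨hs, ?_⟩, fun h => hβ₀ (by simpa using add_mem h hα₀)⟩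
  obtain ⟨γ, hγ, hγ₀, hne⟩ : ∃ γ ∈ Δ, γ ∉ S₀ ∧ c γ ≠ 0 := by
    by_contra! h
    refine hβ₀ (hc ▸ sum_mem fun γ hγ => ?_)
    rw [intCast_smul_dual]
    by_cases hγ₀ : γ ∈ S₀
    · exact zsmul_mem (AddSubgroup.subset_closure hγ₀) _
    · simp [h γ hγ hγ₀, zero_mem]
  refine (hΔ.2.2 _ hs).resolve_left ?_
  rintro ⟨d, hd, hd0⟩
  have hsum : ∑ δ ∈ Δ, ((c - Pi.single α n : Module.Dual ℝ V → ℤ) δ : ℝ) • δ = β - n • α := by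
    simp only [Pi.sub_apply, Int.cast_sub, sub_smul_dual, Finset.sum_sub_distrib]
    rw [← hc, ← intCast_smul_dual,
      Finset.sum_eq_single α (fun δ _ h => by simp [h]) (fun h => (h (hS₀ hα)).elim),
      Pi.single_eq_same]
  have h := hΔ.coeff_unique (hsum.trans hd) γ hγ
  rw [Pi.sub_apply, Pi.single_eq_of_ne (by rintro rfl; exact hγ₀ hα), sub_zero] at h
  exact hne (le_antisymm (hc0 γ hγ) (h ▸ hd0 γ hγ))

lemma IsBase.parabolic_le (hΔ : S.IsBase Δ) (hS₀ : S₀ ⊆ Δ) :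
    S.parabolic S₀ ≤ S.weylGroup :=
  Subgroup.closure_mono fun _ ⟨α, hα, he⟩ => ⟨α, hΔ.1 (hS₀ hα), he⟩

lemma IsBase.polyComp_prod_of_mem_parabolic (hΔ : S.IsBase Δ) (hS₀ : S₀ ⊆ Δ)
    {N : Finset (Module.Dual ℝ V)}
    (hN : (N : Set (Module.Dual ℝ V)) =
      {β | β ∈ S.negRoots Δ ∧ β ∉ AddSubgroup.closure (S₀ : Set (Module.Dual ℝ V))})
    {u : V ≃ₗ[ℝ] V} (hu : u ∈ S.parabolic S₀) :
    polyComp (u : V →ₗ[ℝ] V) (∏ α ∈ N, polyLin α) = ∏ α ∈ N, polyLin α := by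
  classical
  have hmem : ∀ β, β ∈ N ↔ β ∈ S.negRoots Δ ∧
      β ∉ AddSubgroup.closure (S₀ : Set (Module.Dual ℝ V)) := fun β => by
    rw [← Finset.mem_coe, hN, Set.mem_ofPred_eq]
  induction hu using Subgroup.closure_induction with
  | mem e he =>
    obtain ⟨α, hα, he⟩ := he
    have hαR : α ∈ S.R := hΔ.1 (hS₀ hα)
    have hcomp : ∀ β : Module.Dual ℝ V, β ∘ₗ (e : V →ₗ[ℝ] V) = β - β (S.coroot α) • α := by
      intro β
      ext x
      simp [he, mul_comm]
    have hmaps : ∀ β ∈ N, β ∘ₗ (e : V →ₗ[ℝ] V) ∈ N := fun β hβ => by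
      rw [hmem, hcomp]
      exact hΔ.refl_mem_negRoots hS₀ hα ((hmem β).1 hβ).1 ((hmem β).1 hβ).2
    have hinv : ∀ β : Module.Dual ℝ V, (β ∘ₗ (e : V →ₗ[ℝ] V)) ∘ₗ (e : V →ₗ[ℝ] V) = β := by
      intro β
      have hee : e * e = 1 := inv_eq_iff_mul_eq_one.1 (S.inv_eq_of_reflection hαR he)
      ext x
      exact congrArg β (LinearEquiv.congr_fun hee x)
    rw [map_prod]
    exact Finset.prod_nbij' (fun β => β ∘ₗ (e : V →ₗ[ℝ] V)) (fun β => β ∘ₗ (e : V →ₗ[ℝ] V))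
      hmaps hmaps (fun β _ => hinv β) (fun β _ => hinv β) (fun β _ => polyComp_polyLin _ β)
  | one => rfl
  | mul u v _ _ hu hv =>
    change polyComp _ (polyComp _ _) = _
    rw [hu, hv]
  | inv u _ hu =>
    conv_lhs => rw [← hu]
    refine Subtype.ext (funext fun x => ?_)
    exact congrArg _ (u.apply_symm_apply x)

end Base

end RedCrystRootSystem

/-- (Cohomological Weyl character formula, algebraic content.)
With `Δ` a base of the root system, `S₀ ⊆ Δ`, `W_H = ⟨s_α : α ∈ S₀⟩`,
`R_H = R ∩ ℤ-span(S₀)`, `N = R₋ \ R_H`, `Sym(V*)` the symmetric algebra of `V*` with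
fraction field `Q`, and `π = ∏_{α ∈ N} α ∈ Sym(V*)` (a non-zero element), one has:
(i) `u(π) = π` for all `u ∈ W_H`; (ii) for every `W_H`-invariant `f ∈ Sym(V*)`, the
element `w(f·π⁻¹) ∈ Q` depends only on the coset `w·W_H`, and
`Σ_{[w] ∈ W/W_H} w(f·π⁻¹)` lies in `Sym(V*) ⊆ Q` and is `W`-invariant. -/
theorem statement8 {V : Type*} [AddCommGroup V] [Module ℝ V] [FiniteDimensional ℝ V]
    (S : RedCrystRootSystem V)
    (hspan : Submodule.span ℝ (↑S.R : Set (Module.Dual ℝ V)) = ⊤)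
    (Δ : Finset (Module.Dual ℝ V)) (hΔ : S.IsBase Δ)
    (S₀ : Finset (Module.Dual ℝ V)) (hS₀ : S₀ ⊆ Δ)
    -- `N = R₋ \ R_H` where `R_H = R ∩ ℤ-span(S₀)`
    (N : Finset (Module.Dual ℝ V))
    (hN : (↑N : Set (Module.Dual ℝ V)) =
      {β | β ∈ S.negRoots Δ ∧
        β ∉ AddSubgroup.closure (↑S₀ : Set (Module.Dual ℝ V))})
    -- the fraction field `Q` of `Sym(V*)` ...
    (Q : Type*) [Field Q] [Algebra ↥(polyAlg V) Q] [IsFractionRing ↥(polyAlg V) Q]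
    -- ... to which the `W`-action `f ↦ f ∘ w⁻¹` extends
    (act : (V ≃ₗ[ℝ] V) → (Q ≃+* Q))
    (hact : ∀ w ∈ S.weylGroup, ∀ p p' : ↥(polyAlg V),
      (↑p' : V → ℝ) = (↑p : V → ℝ) ∘ ⇑(w⁻¹ : V ≃ₗ[ℝ] V) →
      act w (algebraMap ↥(polyAlg V) Q p) = algebraMap ↥(polyAlg V) Q p')
    -- `π = ∏_{α ∈ N} α`, as an element of `Sym(V*)`
    (πP : ↥(polyAlg V)) (hπ : (↑πP : V → ℝ) = fun x => ∏ α ∈ N, α x) :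
    -- `Sym(V*)` is an integral domain and `π` is non-zero
    IsDomain ↥(polyAlg V) ∧ πP ≠ 0 ∧
    -- (i) `u(π) = π` for every `u ∈ W_H`
    (∀ u : V ≃ₗ[ℝ] V, u ∈ S.parabolic S₀ →
      (↑πP : V → ℝ) ∘ ⇑(u⁻¹ : V ≃ₗ[ℝ] V) = (↑πP : V → ℝ)) ∧
    -- (ii) for every `W_H`-invariant `f ∈ Sym(V*)`:
    ∀ f : ↥(polyAlg V),
      (∀ u : V ≃ₗ[ℝ] V, u ∈ S.parabolic S₀ →
        (↑f : V → ℝ) ∘ ⇑(u⁻¹ : V ≃ₗ[ℝ] V) = (↑f : V → ℝ)) →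
      -- `w(f·π⁻¹)` depends only on the left coset `w·W_H` ...
      (∀ w w' : V ≃ₗ[ℝ] V, w ∈ S.weylGroup → w' ∈ S.weylGroup →
        w⁻¹ * w' ∈ S.parabolic S₀ →
        act w (algebraMap ↥(polyAlg V) Q f / algebraMap ↥(polyAlg V) Q πP) =
          act w' (algebraMap ↥(polyAlg V) Q f / algebraMap ↥(polyAlg V) Q πP)) ∧
      -- ... and for any system `w₁, …, w_m` of representatives of the left cosets
      -- `W/W_H`, the sum `Σᵢ wᵢ(f·π⁻¹)` lies in `Sym(V*)` and is `W`-invariant.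
      ∀ (m : ℕ) (rep : Fin m → (V ≃ₗ[ℝ] V)),
        (∀ i, rep i ∈ S.weylGroup) →
        (∀ w ∈ S.weylGroup, ∃! i, (rep i)⁻¹ * w ∈ S.parabolic S₀) →
        (∃ g : ↥(polyAlg V),
          algebraMap ↥(polyAlg V) Q g =
            ∑ i, act (rep i)
              (algebraMap ↥(polyAlg V) Q f / algebraMap ↥(polyAlg V) Q πP)) ∧
        (∀ w ∈ S.weylGroup,
          act w (∑ i, act (rep i)
              (algebraMap ↥(polyAlg V) Q f / algebraMap ↥(polyAlg V) Q πP)) =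
            ∑ i, act (rep i)
              (algebraMap ↥(polyAlg V) Q f / algebraMap ↥(polyAlg V) Q πP)) := by
  classical
  have hhalf := hΔ.isHalf
  set T : Finset (Module.Dual ℝ V) := {β ∈ S.R | β ∈ S.negRoots Δ}
  set D : polyAlg V := ∏ α ∈ T, polyLin α
  have hNT : N ⊆ T := by
    intro β hβ
    have hβ' : β ∈ (N : Set (Module.Dual ℝ V)) := hβ
    rw [hN] at hβ'
    exact Finset.mem_filter.2 ⟨hβ'.1.1, hβ'.1⟩
  have hπP : πP = ∏ α ∈ N, polyLin α := by
    refine Subtype.ext ?_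
    rw [hπ]
    ext x
    simp [Finset.prod_apply]
  have hpar := hΔ.parabolic_le hS₀
  have hπ0 : πP ≠ 0 := hπP ▸ hhalf.prod_ne_zero hNT
  have hD0 : D ≠ 0 := hhalf.prod_ne_zero subset_rfl
  have hπinv : ∀ u ∈ S.parabolic S₀,
      polyComp ((u⁻¹ : V ≃ₗ[ℝ] V) : V →ₗ[ℝ] V) πP = πP := fun u hu => by
    rw [hπP]
    exact hΔ.polyComp_prod_of_mem_parabolic hS₀ hN (inv_mem hu)
  have hactP : ∀ w ∈ S.weylGroup, ∀ p : polyAlg V, act w (algebraMap _ Q p) =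
      algebraMap _ Q (polyComp ((w⁻¹ : V ≃ₗ[ℝ] V) : V →ₗ[ℝ] V) p) :=
    fun w hw p => hact w hw _ _ rfl
  have hactmul : ∀ w ∈ S.weylGroup, ∀ w' ∈ S.weylGroup, ∀ x : Q,
      act w (act w' x) = act (w * w') x := by
    intro w hw w' hw' x
    obtain ⟨a, b, -, rfl⟩ := IsFractionRing.div_surjective (A := polyAlg V) x
    simp only [map_div₀, hactP _ hw, hactP _ hw', hactP _ (mul_mem hw hw')]
    simp only [mul_inv_rev]
    rfl
  refine ⟨inferInstance, hπ0, fun u hu => congrArg Subtype.val (hπinv u hu), fun f hf => ?_⟩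
  have hfinv : ∀ u ∈ S.parabolic S₀,
      polyComp ((u⁻¹ : V ≃ₗ[ℝ] V) : V →ₗ[ℝ] V) f = f := fun u hu => Subtype.ext (hf u hu)
  have hcoset : ∀ w w' : V ≃ₗ[ℝ] V, w ∈ S.weylGroup → w' ∈ S.weylGroup →
      w⁻¹ * w' ∈ S.parabolic S₀ →
      act w (algebraMap _ Q f / algebraMap _ Q πP) =
        act w' (algebraMap _ Q f / algebraMap _ Q πP) := by
    intro w w' hw hw' h
    have hu : act (w⁻¹ * w') (algebraMap _ Q f / algebraMap _ Q πP) =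
        algebraMap _ Q f / algebraMap _ Q πP := by
      rw [map_div₀, hactP _ (hpar h), hactP _ (hpar h), hfinv _ h, hπinv _ h]
    conv_lhs => rw [← hu]
    rw [hactmul w hw _ (hpar h), mul_inv_cancel_left]
  refine ⟨hcoset, fun m rep hrep huniq => ?_⟩
  set x : Q := algebraMap _ Q f / algebraMap _ Q πP with hx
  have hinvar : ∀ w ∈ S.weylGroup, act w (∑ i, act (rep i) x) = ∑ i, act (rep i) x := by
    intro w hw
    choose j hj _ using fun i => huniq (w * rep i) (mul_mem hw (hrep i))
    have hjinj : Function.Injective j := by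
      intro i i' h
      have h1 := mul_mem (inv_mem (hj i)) (h ▸ hj i')
      have h2 : (rep i)⁻¹ * rep i' ∈ S.parabolic S₀ := by
        convert h1 using 1
        group
      exact (huniq (rep i') (hrep i')).unique h2 (by simp [one_mem])
    rw [map_sum, ← (Finite.injective_iff_bijective.1 hjinj).sum_comp fun i => act (rep i) x]
    refine Finset.sum_congr rfl fun i _ => ?_
    rw [hactmul w hw _ (hrep i)]
    exact (hcoset _ _ (hrep _) (mul_mem hw (hrep i)) (hj i)).symm
  refine ⟨?_, hinvar⟩
  have hdvd : ∀ i, polyComp (((rep i)⁻¹ : V ≃ₗ[ℝ] V) : V →ₗ[ℝ] V) πP ∣ D := fun i => by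
    rw [hπP]
    exact hhalf.polyComp_prod_dvd (inv_mem (hrep i)) hNT
  choose q hq using hdvd
  have hinj := IsFractionRing.injective (polyAlg V) Q
  set P : polyAlg V := ∑ i, polyComp (((rep i)⁻¹ : V ≃ₗ[ℝ] V) : V →ₗ[ℝ] V) f * q i with hP
  have hDQ : algebraMap _ Q D ≠ 0 := (map_ne_zero_iff _ hinj).2 hD0
  have hPQ : algebraMap _ Q P = algebraMap _ Q D * ∑ i, act (rep i) x := by
    rw [hP, map_sum, Finset.mul_sum]
    refine Finset.sum_congr rfl fun i _ => ?_
    have hne : algebraMap _ Q (polyComp (((rep i)⁻¹ : V ≃ₗ[ℝ] V) : V →ₗ[ℝ] V) πP) ≠ 0 := by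
      rw [← hactP _ (hrep i)]
      exact (map_ne_zero _).2 ((map_ne_zero_iff _ hinj).2 hπ0)
    rw [hx, map_div₀, hactP _ (hrep i), hactP _ (hrep i)]
    conv_rhs => rw [hq i]
    rw [map_mul, map_mul]
    field_simp
  obtain ⟨g, hg⟩ : D ∣ P := by
    refine hhalf.prod_dvd_of_polyComp_eq_neg fun β hβ e he => hinj ?_
    have hβR := hhalf.subset hβ
    have hew : e ∈ S.weylGroup := Subgroup.subset_closure ⟨β, hβR, he⟩
    have h := congrArg (act e) hPQ
    rw [map_mul, hinvar e hew, hactP e hew, hactP e hew, S.inv_eq_of_reflection hβR he,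
      hhalf.polyComp_reflection_prod hβ he, map_neg, neg_mul, ← hPQ] at h
    rw [h, map_neg]
  refine ⟨g, mul_left_cancel₀ hDQ ?_⟩
  rw [← hPQ, hg, map_mul]
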